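/- arXiv:1609.06430 — 4 statements merged into one kernel-verified Lean document; each statement's English description precedes it below -/
import Mathlib

section
/- Let m machines have working powers μ(i) and idle powers γ(i), and let Γ = Σ_{i=1}^{m} γ(i). Fix r with 2 ≤ r ≤ m and a total work W > 0. Suppose τ is a schedule using the first r machines (τ(i) ≥ 0 for i ≤ r, τ(i) = 0 for i > r, Σ_{i=1}^{r} τ(i) = W, and the makespan equals τ(1) = max_i τ(i)), and τ' is a schedule using the first r−1 machines (τ'(i) ≥ 0 for i ≤ r−1, τ'(i) = 0 for i ≥ r, Σ_{i=1}^{r-1} τ'(i) = W, makespan τ'(1) = max_i τ'(i)). Writing s(i) = τ'(i) − τ(i) for 1 ≤ i ≤ r−1, the energies E(σ) = Σ_{i}(μ(i) − γ(i))σ(i) + Γ·(makespan of σ) satisfy E(τ') − E(τ) = Σ_{i=1}^{r-1} (μ(i) − γ(i) − μ(r) + γ(r))·s(i) + s(1)·Γ. Hence using r machines consumes strictly less energy than using r−1 machines if and only if Σ_{i=1}^{r-1} (μ(i) − γ(i) − μ(r) + γ(r))·s(i) + s(1)·Γ > 0. -/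
/-- Energy difference between using the first r−1 machines and the first r
machines (identical unit speed, divisible work), and the criterion for r
machines to consume strictly less energy. -/
theorem energy_difference_r_vs_r_minus_one (m r : ℕ) (hm : 0 < m)
    (hr : 2 ≤ r) (hrm : r ≤ m)
    (μ γ : Fin m → ℝ) (hγ0 : ∀ i, 0 ≤ γ i) (hγμ : ∀ i, γ i ≤ μ i)
    (hmono : ∀ i j : Fin m, i ≤ j → μ i - γ i ≤ μ j - γ j)
    (Γ W : ℝ) (hΓ : Γ = ∑ i, γ i) (hW : 0 < W)
    (τ τ' : Fin m → ℝ)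
    -- schedule τ uses the first r machines
    (hτpos : ∀ i : Fin m, (i : ℕ) < r → 0 ≤ τ i)
    (hτzero : ∀ i : Fin m, r ≤ (i : ℕ) → τ i = 0)
    (hτsum : ∑ i, τ i = W)
    (hτmax : ∀ i, τ i ≤ τ ⟨0, hm⟩)
    -- schedule τ' uses the first r−1 machines
    (hτ'pos : ∀ i : Fin m, (i : ℕ) < r - 1 → 0 ≤ τ' i)
    (hτ'zero : ∀ i : Fin m, r - 1 ≤ (i : ℕ) → τ' i = 0)
    (hτ'sum : ∑ i, τ' i = W)
    (hτ'max : ∀ i, τ' i ≤ τ' ⟨0, hm⟩)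
    (s : Fin m → ℝ) (hs : ∀ i, s i = τ' i - τ i)
    (cr : Fin m) (hcr : (cr : ℕ) = r - 1)
    (E : (Fin m → ℝ) → ℝ)
    (hE : E = fun σ => (∑ i, (μ i - γ i) * σ i) + Γ * σ ⟨0, hm⟩)
    (D : ℝ)
    (hD : D = (∑ i ∈ Finset.univ.filter (fun i : Fin m => (i : ℕ) < r - 1),
        (μ i - γ i - μ cr + γ cr) * s i) + s ⟨0, hm⟩ * Γ) :
    E τ' - E τ = D ∧ (E τ < E τ' ↔ 0 < D) := by
  have hfilter : ∑ i ∈ Finset.univ.filter (fun i : Fin m => (i : ℕ) < r - 1),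
      (μ i - γ i - μ cr + γ cr) * s i = ∑ i, (μ i - γ i - μ cr + γ cr) * s i := by
    refine Finset.sum_subset (Finset.filter_subset _ _) fun i _ hi => ?_
    have hi' : r - 1 ≤ (i : ℕ) := by simpa using hi
    rcases hi'.eq_or_lt with h | h
    · obtain rfl : i = cr := Fin.ext (by omega)
      ring
    · rw [hs, hτ'zero i hi', hτzero i (by omega)]
      ring
  have hsum : ∑ i, (μ i - γ i - μ cr + γ cr) * s i =
      ∑ i, (μ i - γ i) * τ' i - ∑ i, (μ i - γ i) * τ i
        - (μ cr - γ cr) * (∑ i, τ' i - ∑ i, τ i) := by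
    rw [← Finset.sum_sub_distrib, ← Finset.sum_sub_distrib, Finset.mul_sum,
      ← Finset.sum_sub_distrib]
    refine Finset.sum_congr rfl fun i _ => ?_
    rw [hs]
    ring
  have hdiff : E τ' - E τ = D := by
    rw [hD, hE, hfilter, hsum, hτsum, hτ'sum, hs]
    ring
  exact ⟨hdiff, by rw [← hdiff, sub_pos]⟩
end

section
/- Let m machines have working powers μ(i) and idle powers γ(i) with Γ = Σ_{i=1}^{m} γ(i), indexed so that μ(i) − γ(i) is nondecreasing, and fix r ≥ 2 working machines and total work W > 0. Let E' be the energy of the equal distribution τ(i) = W/r for 1 ≤ i ≤ r (τ(i) = 0 otherwise, makespan W/r), and let E'' be the energy of the unequal distribution τ(1) = W/r + ε, τ(r) = W/r − ε with 0 < ε ≤ W/r, τ(i) = W/r for 2 ≤ i ≤ r−1, τ(i) = 0 for i > r (makespan W/r + ε). Then E'' − E' = ε·[(μ(1) − γ(1) − μ(r) + γ(r)) + Γ]. In particular, if (μ(1) − γ(1)) − (μ(r) − γ(r)) + Γ > 0, then E'' > E', so the equal distribution W/r on all r working machines consumes strictly less energy than the unequal one. -/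
/-- Equal distribution of work among the r working machines consumes less
energy than a perturbed unequal distribution. -/
theorem equal_distribution_minimizes_energy (m r : ℕ) (hm : 0 < m)
    (hr : 2 ≤ r) (hrm : r ≤ m)
    (μ γ : Fin m → ℝ) (hγ0 : ∀ i, 0 ≤ γ i) (hγμ : ∀ i, γ i ≤ μ i)
    (hmono : ∀ i j : Fin m, i ≤ j → μ i - γ i ≤ μ j - γ j)
    (Γ W ε : ℝ) (hΓ : Γ = ∑ i, γ i) (hW : 0 < W)
    (hε0 : 0 < ε) (hεW : ε ≤ W / r)
    (c1 cr : Fin m) (hc1 : (c1 : ℕ) = 0) (hcr : (cr : ℕ) = r - 1)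
    (τ τ'' : Fin m → ℝ)
    (hτ : τ = fun i : Fin m => if (i : ℕ) < r then W / r else 0)
    (hτ'' : τ'' = fun i : Fin m =>
      if (i : ℕ) = 0 then W / r + ε
      else if (i : ℕ) = r - 1 then W / r - ε
      else if (i : ℕ) < r then W / r else 0)
    (E' E'' : ℝ)
    (hE' : E' = (∑ i, (μ i - γ i) * τ i) + Γ * (W / r))
    (hE'' : E'' = (∑ i, (μ i - γ i) * τ'' i) + Γ * (W / r + ε)) :
    E'' - E' = ε * ((μ c1 - γ c1 - μ cr + γ cr) + Γ) ∧
    ((μ c1 - γ c1) - (μ cr - γ cr) + Γ > 0 → E' < E'') := by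
  have hτ_diff : ∀ i, τ'' i = τ i + ((if i = c1 then ε else 0) - if i = cr then ε else 0) := by
    intro i
    simp only [hτ, hτ'', Fin.ext_iff, hc1, hcr]
    split_ifs <;> first | omega | ring
  have hE_diff : E'' - E' = ε * ((μ c1 - γ c1 - μ cr + γ cr) + Γ) := by
    simp only [hE', hE'', hτ_diff, mul_add, mul_sub, Finset.sum_add_distrib,
      Finset.sum_sub_distrib, mul_ite, mul_zero, Finset.sum_ite_eq', Finset.mem_univ, if_true]
    ring
  refine ⟨hE_diff, fun hpos => sub_pos.mp ?_⟩
  rw [hE_diff]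
  exact mul_pos hε0 (by linarith)
end

section
/- Let p ≥ 0 and q > 0 (representing p = Σ_{i∈R}(μ(i) − γ(i)) + Γ and q = Σ_{i∈R} υ(i) for a working set R), and let machines j and k have a_j = μ(j) − γ(j), a_k = μ(k) − γ(k) and speeds υ(j) > υ(k) > 0. If a_j/υ(j) < p/q, a_k/υ(k) < p/q, and a_j/υ(j) < a_k/υ(k), then (p + a_j)/(q + υ(j)) < (p + a_k)/(q + υ(k)); that is, adding machine j to the working set yields strictly smaller energy consumption than adding machine k, so j should be chosen over k. -/
/-- Among two candidate machines j and k both qualifying for inclusion, if j is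
faster and has the smaller ratio (μⱼ−γⱼ)/υⱼ, then adding j yields strictly
smaller energy than adding k. -/
theorem prefer_faster_smaller_ratio_machine (p q aj ak vj vk : ℝ)
    (hp : 0 ≤ p) (hq : 0 < q)
    (hvk : 0 < vk) (hvjk : vk < vj)
    (hj : aj / vj < p / q) (hk : ak / vk < p / q)
    (hjk : aj / vj < ak / vk) :
    (p + aj) / (q + vj) < (p + ak) / (q + vk) := by
  have hvj : 0 < vj := hvk.trans hvjk
  obtain ⟨s, rfl⟩ : ∃ s, ak = s * vk := ⟨ak / vk, (div_mul_cancel₀ ak hvk.ne').symm⟩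
  rw [mul_div_cancel_right₀ s hvk.ne'] at hk hjk
  rw [lt_div_iff₀ hq] at hk
  rw [div_lt_iff₀ hvj] at hjk
  rw [div_lt_div_iff₀ (by positivity) (by positivity)]
  linarith [mul_pos (sub_pos.2 hk) (sub_pos.2 hvjk), mul_pos hq (sub_pos.2 hjk),
    mul_pos hvk (sub_pos.2 hjk)]
end

section
/- Let p ≥ 0 and q > 0 (representing p = Σ_{i∈R}(μ(i) − γ(i)) + Γ and q = Σ_{i∈R} υ(i) for a working set R), and let machines j and k have a_j = μ(j) − γ(j), a_k = μ(k) − γ(k) and speeds 0 < υ(j) < υ(k). Suppose a_j/υ(j) < a_k/υ(k) < p/q and (p + a_j)/(q + υ(j)) > (p + a_k)/(q + υ(k)). Then (p + a_j + a_k)/(q + υ(j) + υ(k)) < (p + a_j)/(q + υ(j)); that is, even if machine j is added to the working set before machine k, machine k will still be included in the optimal working set, since including k after j strictly decreases the energy consumption. -/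
/-- Even if machine j is added to the working set before machine k, machine k
will still be included: adding k after j strictly decreases the energy. -/
theorem slower_machine_still_included (p q aj ak vj vk : ℝ)
    (hp : 0 ≤ p) (hq : 0 < q)
    (hvj : 0 < vj) (hvjk : vj < vk)
    (hjk : aj / vj < ak / vk) (hkp : ak / vk < p / q)
    (hout : (p + ak) / (q + vk) < (p + aj) / (q + vj)) :
    (p + aj + ak) / (q + vj + vk) < (p + aj) / (q + vj) := by
  have hvk : 0 < vk := hvj.trans hvjk
  have hk : ak / vk < (p + ak) / (q + vk) := by
    rw [div_lt_div_iff₀ hvk hq] at hkp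
    rw [div_lt_div_iff₀ hvk (by positivity)]
    linarith
  have h := hk.trans hout
  rw [div_lt_div_iff₀ hvk (by positivity)] at h
  rw [div_lt_div_iff₀ (by positivity) (by positivity)]
  linarith
end
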